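/- For every integer r ≥ 1 there exists a real constant d_r > 0 such that for every integer s with 1 ≤ s ≤ r and all integers n_1, ..., n_s with 1 < n_1 | n_2 | ... | n_s, the group G = C_{n_1} ⊕ ... ⊕ C_{n_s}, which has exponent n = n_s, satisfies k(G) ≤ d_r·ω(n). -/

import Mathlib

open scoped BigOperators

attribute [local instance] Classical.propDecidable

/-- A sequence (multiset) over `G` is zero-sumfree if no nonempty sub-multiset sums to `0`. -/
def IsZeroSumFree {G : Type*} [AddCommGroup G] (S : Multiset G) : Prop :=
  ∀ T : Multiset G, T ≤ S → T ≠ 0 → T.sum ≠ 0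

/-- A minimal zero-sum sequence: sum `0`, and no nonempty proper sub-multiset sums to `0`. -/
def IsMinimalZeroSum {G : Type*} [AddCommGroup G] (S : Multiset G) : Prop :=
  S.sum = 0 ∧ ∀ T : Multiset G, T < S → T ≠ 0 → T.sum ≠ 0

/-- The cross number of a sequence: `k(S) = Σ_{g ∈ S} 1/ord(g)`. -/
noncomputable def crossNumber {G : Type*} [AddCommGroup G] (S : Multiset G) : ℝ :=
  (S.map fun g => (1 : ℝ) / (addOrderOf g)).sum

/-- The little cross number `k(G)`: max of `k(S)` over zero-sumfree sequences `S` over `G`. -/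
noncomputable def littleCrossNumber (G : Type*) [AddCommGroup G] : ℝ :=
  sSup {x : ℝ | ∃ S : Multiset G, IsZeroSumFree S ∧ crossNumber S = x}

/-- The cross number `K(G)`: max of `k(S)` over minimal zero-sum sequences `S` over `G`. -/
noncomputable def bigCrossNumber (G : Type*) [AddCommGroup G] : ℝ :=
  sSup {x : ℝ | ∃ S : Multiset G, IsMinimalZeroSum S ∧ crossNumber S = x}

/-- The Davenport constant `D(G)`. -/
noncomputable def davenport (G : Type*) [AddCommGroup G] : ℕ :=
  sInf {t | 1 ≤ t ∧ ∀ S : Multiset G, t ≤ Multiset.card S →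
    ∃ T, T ≤ S ∧ T ≠ 0 ∧ T.sum = 0}

/-- The constant `η(G)`. -/
noncomputable def etaConst (G : Type*) [AddCommGroup G] : ℕ :=
  sInf {t | 1 ≤ t ∧ ∀ S : Multiset G, t ≤ Multiset.card S →
    ∃ T, T ≤ S ∧ T ≠ 0 ∧ Multiset.card T ≤ AddMonoid.exponent G ∧ T.sum = 0}

/-- `υ_i(d',d) = A_i / gcd(A_i, B_i)` where `A_i = gcd(d', n_i)` and
`B_i = lcm(d, n_i)/lcm(d', n_i)`. -/
def upsilon (ni d' d : ℕ) : ℕ :=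
  Nat.gcd d' ni / Nat.gcd (Nat.gcd d' ni) (Nat.lcm d ni / Nat.lcm d' ni)

/-- `k*` of `C_{n_1} ⊕ ... ⊕ C_{n_r}`, computed from the primary decomposition. -/
noncomputable def kStarTuple {r : ℕ} (n : Fin r → ℕ) : ℝ :=
  ∑ i, ∑ p ∈ (n i).primeFactors,
    ((p ^ ((n i).factorization p) : ℝ) - 1) / (p ^ ((n i).factorization p))

/-- `α(n) = Σ_{d | n} (P⁻(d) − 1)/d`. -/
noncomputable def alphaFn (n : ℕ) : ℝ :=
  ∑ d ∈ n.divisors, ((d.minFac : ℝ) - 1) / d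

/-- `β(n) = Σ_{p | n prime} (p − 1)/p`. -/
noncomputable def betaFn (n : ℕ) : ℝ :=
  ∑ p ∈ n.primeFactors, ((p : ℝ) - 1) / p


lemma Nat.two_mul_card_primes_lt (q : ℕ) (hq : q.Prime) (s : Finset ℕ)
    (hs : ∀ p ∈ s, p.Prime ∧ p < q) : 2 * s.card + 1 ≤ q := by
  have h : s.card ≤ (Finset.range ((q - 1) / 2)).card := by
    refine Finset.card_le_card_of_injOn (fun p => (p - 1) / 2) ?_ ?_
    · intro p hp
      obtain ⟨hp, hlt⟩ := hs p hp
      simp only [Finset.coe_range, Set.mem_Iio]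
      have := hp.two_le
      rcases hp.eq_two_or_odd with h | h <;> rcases hq.eq_two_or_odd with h' | h' <;> omega
    · intro p hp p' hp' h
      obtain ⟨hp, hlt⟩ := hs p hp
      obtain ⟨hp', hlt'⟩ := hs p' hp'
      have := hp.two_le
      have := hp'.two_le
      simp only at h
      rcases hp.eq_two_or_odd with h1 | h1 <;> rcases hp'.eq_two_or_odd with h2 | h2 <;> omega
  rw [Finset.card_range] at h
  have := hq.two_le
  omega

lemma sum_range_inv_pow_le (q : ℕ) (hq : 2 ≤ q) (k : ℕ) :
    ∑ b ∈ Finset.range k, ((q : ℝ) ^ b)⁻¹ ≤ q / (q - 1) := by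
  have hq' : (2 : ℝ) ≤ q := by exact_mod_cast hq
  have h1 : ∑ b ∈ Finset.range k, ((q : ℝ) ^ b)⁻¹ = (((q : ℝ)⁻¹) ^ k - 1) / ((q : ℝ)⁻¹ - 1) := by
    rw [← geom_sum_eq]
    · simp
    · intro h
      rw [inv_eq_one] at h
      linarith
  rw [h1, ← neg_div_neg_eq]
  have h2 : 0 < -((q : ℝ)⁻¹ - 1) := by
    have : (q : ℝ)⁻¹ < 1 := inv_lt_one_of_one_lt₀ (by linarith)
    linarith
  rw [div_le_div_iff₀ h2 (by linarith)]
  have h3 : (0 : ℝ) ≤ (q : ℝ)⁻¹ ^ k := by positivity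
  have h4 : (q : ℝ) * -((q : ℝ)⁻¹ - 1) = q - 1 := by field_simp; ring
  rw [h4]
  nlinarith

/-- The weight `P⁻(d) / d`, where `P⁻` is the least prime factor, set to `0` at `d = 1`. -/
noncomputable def minFacWeight (d : ℕ) : ℝ := if d = 1 then 0 else (d.minFac : ℝ) / d

lemma minFacWeight_mul_le {q : ℕ} (hq : 1 ≤ q) {e : ℕ} (he : e ≠ 1) (b : ℕ) :
    minFacWeight (q ^ b * e) ≤ ((q : ℝ) ^ b)⁻¹ * minFacWeight e := by
  have h1 : q ^ b * e ≠ 1 := fun h => he (Nat.eq_one_of_mul_eq_one_left h)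
  rw [minFacWeight, minFacWeight, if_neg h1, if_neg he]
  have h2 : ((q ^ b * e).minFac : ℝ) ≤ e.minFac := by
    exact_mod_cast Nat.minFac_le_of_dvd (Nat.minFac_prime he).two_le
      ((Nat.minFac_dvd e).trans (Dvd.intro_left _ rfl))
  push_cast
  rw [div_eq_mul_inv, div_eq_mul_inv, mul_inv]
  calc _ ≤ (e.minFac : ℝ) * (((q : ℝ) ^ b)⁻¹ * (e : ℝ)⁻¹) := by gcongr
    _ = _ := by ring

lemma sum_minFacWeight_prime_pow_mul_le {q a m : ℕ} (hq : q.Prime) (hm : m ≠ 0)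
    (hqm : ¬ q ∣ m) :
    ∑ d ∈ (q ^ a * m).divisors, minFacWeight d ≤
      q / (q - 1) * (1 + ∑ d ∈ m.divisors, minFacWeight d) := by
  have hcop : Nat.Coprime (q ^ a) m := ((Nat.Prime.coprime_iff_not_dvd hq).2 hqm).pow_left a
  have h1 : ∑ d ∈ (q ^ a * m).divisors, minFacWeight d =
      ∑ b ∈ Finset.range (a + 1), ∑ e ∈ m.divisors, minFacWeight (q ^ b * e) := by
    rw [Nat.divisors_mul, Finset.mul_def, Finset.sum_image hcop.mul_injOn_divisors,
      Finset.sum_product, Nat.sum_divisors_prime_pow hq]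
  have hone : 1 ∈ m.divisors := by simp [hm]
  have hF : ∑ d ∈ m.divisors, minFacWeight d = ∑ d ∈ m.divisors.erase 1, minFacWeight d := by
    rw [← Finset.add_sum_erase _ _ hone]; simp [minFacWeight]
  have hnn : ∀ d, 0 ≤ minFacWeight d := by
    intro d; rw [minFacWeight]; split_ifs <;> positivity
  have h2 : ∀ b, ∑ e ∈ m.divisors, minFacWeight (q ^ b * e) ≤
      minFacWeight (q ^ b) + ((q : ℝ) ^ b)⁻¹ * ∑ d ∈ m.divisors, minFacWeight d := by
    intro b
    rw [← Finset.add_sum_erase _ _ hone, mul_one, hF, Finset.mul_sum]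
    gcongr with e he
    exact minFacWeight_mul_le hq.one_le (Finset.ne_of_mem_erase he) b
  have h3 : ∑ b ∈ Finset.range (a + 1), minFacWeight (q ^ b) =
      ∑ b ∈ Finset.range a, ((q : ℝ) ^ b)⁻¹ := by
    rw [Finset.sum_range_succ']
    have : minFacWeight (q ^ 0) = 0 := by simp [minFacWeight]
    rw [this, add_zero]
    refine Finset.sum_congr rfl fun b _ => ?_
    rw [minFacWeight, if_neg, hq.pow_minFac (by omega)]
    · have := hq.pos
      push_cast
      field_simp
      ring
    · exact (Nat.one_lt_pow (by omega) hq.one_lt).ne'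
  rw [h1]
  refine (Finset.sum_le_sum fun b _ => h2 b).trans ?_
  rw [Finset.sum_add_distrib, h3, ← Finset.sum_mul, mul_add, mul_one]
  have := Finset.sum_nonneg fun d (_ : d ∈ m.divisors) => hnn d
  gcongr <;> exact sum_range_inv_pow_le q hq.two_le _

/-- The sum of `P⁻(d) / d` over the nontrivial divisors `d` of `n` is `O(ω(n))`. -/
lemma sum_minFacWeight_le (n : ℕ) (hn : n ≠ 0) :
    ∑ d ∈ n.divisors, minFacWeight d ≤ 4 * n.primeFactors.card := by
  induction n using Nat.strong_induction_on with
  | _ n ih =>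
  rcases eq_or_ne n 1 with rfl | h1
  · simp [minFacWeight]
  have hne : n.primeFactors.Nonempty := Nat.nonempty_primeFactors.2 (by omega)
  set q := n.primeFactors.max' hne with hqdef
  have hqmem : q ∈ n.primeFactors := Finset.max'_mem _ _
  have hq : q.Prime := Nat.prime_of_mem_primeFactors hqmem
  have hqn : q ∣ n := Nat.dvd_of_mem_primeFactors hqmem
  obtain ⟨a, m, hqm, hnm⟩ := Nat.exists_eq_pow_mul_and_not_dvd hn q hq.ne_one
  have hm0 : m ≠ 0 := by rintro rfl; simp at hqm
  have ha : a ≠ 0 := by rintro rfl; simp at hnm; exact hqm (hnm ▸ hqn)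
  have hpf : n.primeFactors = insert q m.primeFactors := by
    rw [hnm, Nat.primeFactors_mul (pow_ne_zero _ hq.ne_zero) hm0, Nat.primeFactors_pow _ ha,
      hq.primeFactors]
    rfl
  have hqnot : q ∉ m.primeFactors := fun h => hqm (Nat.dvd_of_mem_primeFactors h)
  have hcard : n.primeFactors.card = m.primeFactors.card + 1 := by
    rw [hpf, Finset.card_insert_of_notMem hqnot]
  have hlt : m < n := by
    rw [hnm]
    exact lt_mul_of_one_lt_left (Nat.pos_of_ne_zero hm0) (Nat.one_lt_pow ha hq.one_lt)
  have hF := ih m hlt hm0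
  have hq2 : 2 * m.primeFactors.card + 1 ≤ q := by
    refine Nat.two_mul_card_primes_lt q hq _ fun p hp => ⟨Nat.prime_of_mem_primeFactors hp, ?_⟩
    refine lt_of_le_of_ne (Finset.le_max' _ _ ?_) (by rintro rfl; exact hqnot hp)
    rw [hpf]; exact Finset.mem_insert_of_mem hp
  have hmain := sum_minFacWeight_prime_pow_mul_le (a := a) hq hm0 hqm
  rw [← hnm] at hmain
  refine hmain.trans ?_
  rw [hcard]
  have hq' : (2 : ℝ) ≤ q := by exact_mod_cast hq.two_le
  have hq2' : 2 * (m.primeFactors.card : ℝ) + 1 ≤ q := by exact_mod_cast hq2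
  push_cast
  rw [div_mul_eq_mul_div, div_le_iff₀ (by linarith)]
  nlinarith

section PolynomialFunctions

variable {p : ℕ} {V : Type*} [AddCommGroup V]

/-- Functions killed by any `k` finite differences, i.e. of degree less than `k`. -/
def polyFun (p : ℕ) (V : Type*) [AddCommGroup V] : ℕ → Submodule (ZMod p) (V → ZMod p)
  | 0 => ⊥
  | k + 1 =>
    { carrier := {f | ∀ h, (fun x => f (x + h) - f x) ∈ polyFun p V k}
      add_mem' := by
        intro f g hf hg h
        convert (polyFun p V k).add_mem (hf h) (hg h) using 1
        ext x; simp only [Pi.add_apply]; ring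
      zero_mem' := by
        intro h
        convert (polyFun p V k).zero_mem using 1
        ext x; simp
      smul_mem' := by
        intro c f hf h
        convert (polyFun p V k).smul_mem c (hf h) using 1
        ext x; simp only [Pi.smul_apply, smul_eq_mul]; ring }

lemma translate_mem_polyFun {k : ℕ} {f : V → ZMod p} (hf : f ∈ polyFun p V k) (g : V) :
    (fun x => f (x + g)) ∈ polyFun p V k := by
  induction k generalizing f with
  | zero =>
    have : f = 0 := hf
    subst this
    exact (polyFun p V 0).zero_mem
  | succ k ih =>
    intro h
    convert ih (hf h) using 3
    rw [add_right_comm]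

lemma mul_mem_polyFun {k : ℕ} {f l : V → ZMod p} {c : V → ZMod p}
    (hl : ∀ x h, l (x + h) = l x + c h) (hf : f ∈ polyFun p V k) :
    (fun x => l x * f x) ∈ polyFun p V (k + 1) := by
  induction k generalizing f with
  | zero =>
    have : f = 0 := hf
    subst this
    convert (polyFun p V 1).zero_mem using 1
    ext x; simp
  | succ k ih =>
    intro h
    convert (polyFun p V (k + 1)).add_mem (ih (hf h))
      ((polyFun p V (k + 1)).smul_mem (c h) (translate_mem_polyFun hf h)) using 1
    ext x
    simp only [Pi.add_apply, Pi.smul_apply, smul_eq_mul, hl]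
    ring

lemma prod_mem_polyFun {ι : Type*} (s : Finset ι) (l : ι → V → ZMod p) (c : ι → V → ZMod p)
    (hl : ∀ i x h, l i (x + h) = l i x + c i h) :
    (fun x => ∏ i ∈ s, l i x) ∈ polyFun p V (s.card + 1) := by
  induction s using Finset.induction_on with
  | empty =>
    rw [Finset.card_empty]
    intro h
    convert (polyFun p V 0).zero_mem using 1
    ext x; simp
  | insert a s ha ih =>
    rw [Finset.card_insert_of_notMem ha]
    convert mul_mem_polyFun (hl a) ih using 2
    rw [Finset.prod_insert ha]

/-- A finite set is `k`-unisolvent if no nonzero function of degree at most `k` vanishes on it. -/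
def Unisolvent (p : ℕ) {V : Type*} [AddCommGroup V] (k : ℕ) (Y : Finset V) : Prop :=
  ∀ f ∈ polyFun p V (k + 1), (∀ y ∈ Y, f y = 0) → f = 0

lemma Unisolvent.nonempty [Fact p.Prime] {k : ℕ} {Y : Finset V} (hY : Unisolvent p k Y) :
    Y.Nonempty := by
  by_contra h
  rw [Finset.not_nonempty_iff_eq_empty] at h
  have h1 : (fun _ : V => (1 : ZMod p)) ∈ polyFun p V (k + 1) := by
    induction k with
    | zero => 
      intro h
      convert (polyFun p V 0).zero_mem using 1
      ext x; simp
    | succ k ih => 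
      intro h
      convert (polyFun p V (k + 1)).zero_mem using 1
      ext x; simp
  have := congrFun (hY _ h1 (by simp [h])) 0
  simp at this

lemma unisolvent_zero (y : V) : Unisolvent p 0 {y} := by
  intro f hf h
  ext x
  have := congrFun (show (fun z => f (z + (x - y)) - f z) = 0 from hf (x - y)) y
  simpa [h y (by simp)] using this

open scoped Pointwise in
lemma Unisolvent.add [Fact p.Prime] {k : ℕ} {Y B : Finset V} (hY : Unisolvent p k Y)
    (hB : AddSubgroup.closure {v : V | ∃ b ∈ B, ∃ b' ∈ B, v = b - b'} = ⊤) (hne : B.Nonempty) :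
    Unisolvent p (k + 1) (B + Y) := by
  intro f hf h
  have key : ∀ b ∈ B, ∀ b' ∈ B, ∀ x, f (x + b) = f (x + b') := by
    intro b hb b' hb' x
    have h1 : (fun x => f (x + b) - f (x + b')) ∈ polyFun p V (k + 1) := by
      convert translate_mem_polyFun (hf (b - b')) b' using 4
      abel
    have h2 := hY _ h1 fun y hy => by
      rw [add_comm y b, add_comm y b', h _ (Finset.add_mem_add hb hy),
        h _ (Finset.add_mem_add hb' hy), sub_zero]
    exact sub_eq_zero.1 (congrFun h2 x)
  let H : AddSubgroup V :=
    { carrier := {v | ∀ x, f (x + v) = f x}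
      add_mem' := by
        intro v w hv hw x
        rw [← add_assoc, hw, hv]
      zero_mem' := by intro x; rw [add_zero]
      neg_mem' := by
        intro v hv x
        have := hv (x + -v)
        rw [neg_add_cancel_right] at this
        exact this.symm }
  have hH : H = ⊤ := by
    rw [eq_top_iff, ← hB, AddSubgroup.closure_le]
    rintro v ⟨b, hb, b', hb', rfl⟩ x
    have := key b hb b' hb' (x - b')
    rwa [sub_add_cancel, show x - b' + b = x + (b - b') by abel] at this
  obtain ⟨b, hb⟩ := hne
  obtain ⟨y, hy⟩ := hY.nonempty
  ext x
  have h3 : x - (b + y) ∈ H := hH ▸ AddSubgroup.mem_top _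
  have h4 := h3 (b + y)
  rw [add_sub_cancel, h _ (Finset.add_mem_add hb hy)] at h4
  exact h4

lemma Unisolvent.pow_le_card [Fact p.Prime] [Module (ZMod p) V] {d m : ℕ} {Y : Finset V}
    (b : Module.Basis (Fin d) (ZMod p) V) (hm : m < p) (hY : Unisolvent p (d * m) Y) :
    (m + 1) ^ d ≤ Y.card := by
  let s (y : Fin d → Fin (m + 1)) : Finset ((_ : Fin d) × Fin (m + 1)) :=
    Finset.univ.sigma fun i => Finset.univ.erase (y i)
  let l (y : Fin d → Fin (m + 1)) (x : V) : ZMod p :=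
    ∏ j ∈ s y, (b.repr x j.1 - ((j.2 : ℕ) : ZMod p))
  have hl : ∀ y, l y ∈ polyFun p V (d * m + 1) := by
    intro y
    have hs : (s y).card = d * m := by simp [s, Finset.card_sigma]
    rw [← hs]
    refine prod_mem_polyFun (s y) (fun j x => b.repr x j.1 - ((j.2 : ℕ) : ZMod p))
      (fun j h => b.repr h j.1) fun i x h => ?_
    simp only [map_add, Finsupp.add_apply]; ring
  let pt (y : Fin d → Fin (m + 1)) : V := b.equivFun.symm fun i => ((y i : ℕ) : ZMod p)
  have hpt : ∀ y i, b.repr (pt y) i = ((y i : ℕ) : ZMod p) := by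
    intro y i
    rw [← Module.Basis.equivFun_apply, LinearEquiv.apply_symm_apply]
  have hinj : ∀ i j : Fin (m + 1), ((i : ℕ) : ZMod p) - ((j : ℕ) : ZMod p) = 0 → i = j := by
    intro i j h
    rw [sub_eq_zero, ZMod.natCast_eq_natCast_iff', Nat.mod_eq_of_lt (by omega),
      Nat.mod_eq_of_lt (by omega)] at h
    exact Fin.ext h
  have hself : ∀ y, l y (pt y) ≠ 0 := by
    intro y
    refine Finset.prod_ne_zero_iff.2 fun j hj h => ?_
    rw [hpt] at h
    simp only [s, Finset.mem_sigma, Finset.mem_univ, true_and, Finset.mem_erase, and_true] at hj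
    exact hj (hinj _ _ h).symm
  have hother : ∀ y z, y ≠ z → l y (pt z) = 0 := by
    intro y z hyz
    obtain ⟨i, hi⟩ := Function.ne_iff.1 hyz
    refine Finset.prod_eq_zero (i := ⟨i, z i⟩) ?_ ?_
    · simp [s, hi.symm]
    · simp [hpt]
  let Φ : ((Fin d → Fin (m + 1)) → ZMod p) →ₗ[ZMod p] (Y → ZMod p) :=
    { toFun := fun α v => ∑ y, α y * l y v
      map_add' := by
        intro α β; ext v; simp [add_mul, Finset.sum_add_distrib]
      map_smul' := by
        intro c α; ext v; simp [Finset.mul_sum, mul_assoc] }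
  have hΦ : Function.Injective Φ := by
    rw [← LinearMap.ker_eq_bot, LinearMap.ker_eq_bot']
    intro α hα
    have hF : (∑ y, α y • l y) ∈ polyFun p V (d * m + 1) :=
      Submodule.sum_mem _ fun y _ => Submodule.smul_mem _ _ (hl y)
    have hF0 := hY _ hF fun v hv => by
      simpa [Φ] using congrFun hα ⟨v, hv⟩
    ext z
    have h1 := congrFun hF0 (pt z)
    rw [Finset.sum_apply, Finset.sum_eq_single z] at h1
    · simpa [hself z] using h1
    · intro y _ hyz; simp [hother y z hyz]
    · simp
  simpa using LinearMap.finrank_le_finrank_of_injective hΦ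

end PolynomialFunctions

section Expansion

variable {p : ℕ} [Fact p.Prime]

lemma norm_stdAddChar_sub_one_ge (t : ZMod p) :
    4 * (|t.valMinAbs| : ℝ) / p ≤ ‖ZMod.stdAddChar t - 1‖ := by
  have hp : (0 : ℝ) < p := by exact_mod_cast (Fact.out : p.Prime).pos
  have h1 : ZMod.stdAddChar t = Complex.exp (Complex.I * ((2 * Real.pi * t.valMinAbs / p : ℝ))) := by
    conv_lhs => rw [← ZMod.coe_valMinAbs t]
    rw [ZMod.stdAddChar_coe]
    congr 1
    push_cast
    ring
  rw [h1, Complex.norm_exp_I_mul_ofReal_sub_one, Real.norm_eq_abs, abs_mul, abs_two]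
  have h2 : |(t.valMinAbs : ℝ)| * 2 ≤ p := by
    have := ZMod.natAbs_valMinAbs_le t
    have h3 : |t.valMinAbs| * 2 ≤ p := by rw [Int.abs_eq_natAbs]; omega
    exact_mod_cast h3
  have h3 := Real.mul_abs_le_abs_sin (x := 2 * Real.pi * t.valMinAbs / p / 2) (by
    rw [abs_div, abs_div, abs_mul, abs_mul, abs_two, abs_of_pos Real.pi_pos, abs_of_pos hp,
      div_div, div_le_div_iff₀ (by positivity) (by positivity)]
    nlinarith [Real.pi_pos])
  have h4 : |2 * Real.pi * (t.valMinAbs : ℝ) / p / 2| = Real.pi * |(t.valMinAbs : ℝ)| / p := by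
    rw [abs_div, abs_div, abs_mul, abs_mul, abs_two, abs_of_pos Real.pi_pos, abs_of_pos hp]
    ring
  rw [h4] at h3
  calc 4 * (|t.valMinAbs| : ℝ) / p = 2 * (2 / Real.pi * (Real.pi * |(t.valMinAbs : ℝ)| / p)) := by
        field_simp
        ring
    _ ≤ _ := by gcongr

lemma norm_sum_range_stdAddChar_mul_le (t : ZMod p) (J : ℕ) :
    ‖∑ n ∈ Finset.range J, ZMod.stdAddChar ((n : ZMod p) * t)‖ * (2 * (|t.valMinAbs| : ℝ)) ≤ p := by
  have hp : (0 : ℝ) < p := by exact_mod_cast (Fact.out : p.Prime).pos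
  have h1 : ∀ n ∈ Finset.range J,
      ZMod.stdAddChar ((n : ZMod p) * t) = (ZMod.stdAddChar t) ^ n := by
    intro n _
    rw [← AddChar.map_nsmul_eq_pow, nsmul_eq_mul]
  rw [Finset.sum_congr rfl h1]
  have h2 := mul_geom_sum (ZMod.stdAddChar t) J
  have h3 : ‖(ZMod.stdAddChar t) ^ J - 1‖ ≤ 2 := by
    refine (norm_sub_le _ _).trans ?_
    rw [norm_pow, AddChar.norm_apply]
    norm_num
  rw [← h2, norm_mul] at h3
  have h4 := norm_stdAddChar_sub_one_ge t
  rw [div_le_iff₀ hp] at h4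
  have h5 := norm_nonneg (∑ n ∈ Finset.range J, (ZMod.stdAddChar t) ^ n)
  nlinarith [mul_le_mul_of_nonneg_left h4 h5]

variable {V : Type*} [AddCommGroup V] [Module (ZMod p) V] [Finite V]

lemma sum_dual_stdAddChar [Fintype (Module.Dual (ZMod p) V)] (g : V) :
    ∑ u : Module.Dual (ZMod p) V, ZMod.stdAddChar (u g) = if g = 0 then (Nat.card V : ℂ) else 0 := by
  split_ifs with h
  · subst h
    simp only [map_zero, AddChar.map_zero_eq_one, Finset.sum_const, Finset.card_univ,
      nsmul_eq_mul, mul_one, ← Nat.card_eq_fintype_card]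
    have h1 := Module.natCard_eq_pow_finrank (K := ZMod p) (V := V)
    have h2 := Module.natCard_eq_pow_finrank (K := ZMod p) (V := Module.Dual (ZMod p) V)
    rw [Subspace.dual_finrank_eq] at h2
    rw [h1, h2]
  · let ψ : AddChar (Module.Dual (ZMod p) V) ℂ :=
      { toFun := fun u => ZMod.stdAddChar (u g)
        map_zero_eq_one' := by simp
        map_add_eq_mul' := by intro u v; simp [AddChar.map_add_eq_mul] }
    refine AddChar.sum_eq_zero_iff_ne_zero (ψ := ψ) |>.2 fun h0 => h ?_
    rw [← Module.forall_dual_apply_eq_zero_iff (ZMod p)]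
    intro u
    have : ZMod.stdAddChar (u g) = 1 := DFunLike.congr_fun h0 u
    rw [← AddChar.map_zero_eq_one (ZMod.stdAddChar (N := p))] at this
    exact ZMod.injective_stdAddChar this

lemma sum_dual_norm_sq_mul_stdAddChar [Fintype (Module.Dual (ZMod p) V)] (Y : Finset V) (h : V) :
    ∑ u : Module.Dual (ZMod p) V,
      ((‖∑ y ∈ Y, ZMod.stdAddChar (u y)‖ ^ 2 : ℝ) : ℂ) * ZMod.stdAddChar (u h) =
      (Nat.card V : ℂ) * (Y.filter fun y => y + h ∈ Y).card := by
  set e : AddChar (ZMod p) ℂ := ZMod.stdAddChar with he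
  have hff : ∀ u : Module.Dual (ZMod p) V, ((‖∑ y ∈ Y, e (u y)‖ ^ 2 : ℝ) : ℂ) =
      ∑ y ∈ Y, ∑ z ∈ Y, e (u (y - z)) := by
    intro u
    rw [Complex.ofReal_pow, ← Complex.mul_conj', map_sum, Finset.sum_mul_sum]
    refine Finset.sum_congr rfl fun y _ => Finset.sum_congr rfl fun z _ => ?_
    rw [map_sub, sub_eq_add_neg, AddChar.map_add_eq_mul, AddChar.map_neg_eq_conj]
  simp only [hff, Finset.sum_mul]
  rw [Finset.sum_comm]
  have h1 : ∀ y ∈ Y, ∑ u : Module.Dual (ZMod p) V, ∑ z ∈ Y, e (u (y - z)) * e (u h) =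
      if y + h ∈ Y then (Nat.card V : ℂ) else 0 := by
    intro y _
    rw [Finset.sum_comm]
    have h2 : ∀ z ∈ Y, ∑ u : Module.Dual (ZMod p) V, e (u (y - z)) * e (u h) =
        if y + h = z then (Nat.card V : ℂ) else 0 := by
      intro z _
      have h3 : ∀ u : Module.Dual (ZMod p) V, e (u (y - z)) * e (u h) = e (u (y - z + h)) := by
        intro u
        rw [map_add, AddChar.map_add_eq_mul]
      simp only [h3]
      rw [he, sum_dual_stdAddChar]
      congr 1
      rw [sub_add_eq_add_sub, sub_eq_zero]
    rw [Finset.sum_congr rfl h2, Finset.sum_ite_eq]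
  rw [Finset.sum_congr rfl h1, ← Finset.sum_filter, Finset.sum_const, nsmul_eq_mul, mul_comm]

/-- A family of translations with small nontrivial Fourier coefficients moves a positive
proportion of every set of density at most one half. -/
lemma exists_card_inter_translate_le {κ : Type*} (K : Finset κ) (hK : K.Nonempty) (g : κ → V)
    (hg : ∀ u : Module.Dual (ZMod p) V, u ≠ 0 →
      2 * ‖∑ k ∈ K, ZMod.stdAddChar (u (g k))‖ ≤ K.card)
    (Y : Finset V) (hY : 2 * Y.card ≤ Nat.card V) :
    ∃ k ∈ K, 4 * (Y.filter fun y => y + g k ∈ Y).card ≤ 3 * Y.card := by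
  have : Finite (Module.Dual (ZMod p) V) := Module.finite_of_finite (ZMod p)
  have : Fintype (Module.Dual (ZMod p) V) := Fintype.ofFinite _
  set e : AddChar (ZMod p) ℂ := ZMod.stdAddChar with he
  obtain ⟨f, hf⟩ : ∃ f : Module.Dual (ZMod p) V → ℂ, ∀ u, f u = ∑ y ∈ Y, e (u y) :=
    ⟨_, fun _ => rfl⟩
  have hconv : ∀ h : V, ∑ u, ((‖f u‖ ^ 2 : ℝ) : ℂ) * e (u h) =
      (Nat.card V : ℂ) * (Y.filter fun y => y + h ∈ Y).card := by
    intro h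
    simp only [hf]
    exact sum_dual_norm_sq_mul_stdAddChar Y h
  have hV : 0 < Nat.card V := Nat.card_pos
  have hpars : ∑ u, ‖f u‖ ^ 2 = (Nat.card V : ℝ) * Y.card := by
    have := hconv 0
    simp only [add_zero, map_zero, AddChar.map_zero_eq_one, mul_one,
      Finset.filter_true_of_mem (fun y (hy : y ∈ Y) => hy)] at this
    exact_mod_cast this
  have hf0 : ‖f 0‖ ^ 2 = (Y.card : ℝ) ^ 2 := by simp [hf]
  have hsum : ((∑ k ∈ K, (Nat.card V : ℝ) * ((Y.filter fun y => y + g k ∈ Y).card : ℝ) : ℝ) : ℂ) =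
      ∑ u, ((‖f u‖ ^ 2 : ℝ) : ℂ) * ∑ k ∈ K, e (u (g k)) := by
    push_cast
    simp only [Finset.mul_sum]
    rw [Finset.sum_comm]
    refine Finset.sum_congr rfl fun k _ => ?_
    rw [← hconv (g k)]
    push_cast
    rfl
  have hbound : ∑ k ∈ K, (Nat.card V : ℝ) * ((Y.filter fun y => y + g k ∈ Y).card : ℝ) ≤
      K.card / 2 * (∑ u, ‖f u‖ ^ 2) + K.card / 2 * ‖f 0‖ ^ 2 := by
    have h1 : ∑ k ∈ K, (Nat.card V : ℝ) * ((Y.filter fun y => y + g k ∈ Y).card : ℝ) =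
        ‖∑ u, ((‖f u‖ ^ 2 : ℝ) : ℂ) * ∑ k ∈ K, e (u (g k))‖ := by
      rw [← hsum, Complex.norm_real, Real.norm_of_nonneg]
      exact Finset.sum_nonneg fun k _ => mul_nonneg (Nat.cast_nonneg _) (Nat.cast_nonneg _)
    rw [h1]
    refine (norm_sum_le _ _).trans ?_
    have h2 : ∀ u, ‖((‖f u‖ ^ 2 : ℝ) : ℂ) * ∑ k ∈ K, e (u (g k))‖ ≤
        K.card / 2 * ‖f u‖ ^ 2 + if u = 0 then K.card / 2 * ‖f 0‖ ^ 2 else 0 := by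
      intro u
      rw [norm_mul, Complex.norm_real, Real.norm_of_nonneg (by positivity)]
      split_ifs with hu
      · subst hu
        have : ‖∑ k ∈ K, e ((0 : Module.Dual (ZMod p) V) (g k))‖ = K.card := by simp
        rw [this]
        linarith
      · have := hg u hu
        have h3 : (0 : ℝ) ≤ ‖f u‖ ^ 2 := by positivity
        nlinarith
    refine (Finset.sum_le_sum fun u _ => h2 u).trans ?_
    rw [Finset.sum_add_distrib, ← Finset.mul_sum, Finset.sum_ite_eq', if_pos (Finset.mem_univ _)]
  by_contra! hcon
  have hlt : ∑ k ∈ K, (Nat.card V : ℝ) * (3 * Y.card / 4) <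
      ∑ k ∈ K, (Nat.card V : ℝ) * ((Y.filter fun y => y + g k ∈ Y).card : ℝ) := by
    refine Finset.sum_lt_sum_of_nonempty hK fun k hk => ?_
    have : (3 * Y.card : ℝ) < 4 * (Y.filter fun y => y + g k ∈ Y).card := by
      exact_mod_cast hcon k hk
    have hV' : (0 : ℝ) < Nat.card V := by exact_mod_cast hV
    refine mul_lt_mul_of_pos_left ?_ hV'
    linarith
  rw [hpars, hf0] at hbound
  rw [Finset.sum_const, nsmul_eq_mul] at hlt
  have hY' : (2 * Y.card : ℝ) ≤ Nat.card V := by exact_mod_cast hY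
  have hKc : (0 : ℝ) < K.card := by exact_mod_cast hK.card_pos
  have h6 : (0 : ℝ) ≤ (K.card : ℝ) * Y.card := by positivity
  nlinarith [mul_le_mul_of_nonneg_left hY' h6]

end Expansion

section PairGrowth

variable {p : ℕ} [Fact p.Prime]

/-- The number of elements of `Y` moved out of `Y` by a multiple of `h`. -/
lemma card_moved_nsmul_le {V : Type*} [AddCommGroup V] (Y : Finset V) (h : V) (n : ℕ) :
    (Y.filter fun y => y + n • h ∉ Y).card ≤ n * (Y.filter fun y => y + h ∉ Y).card := by
  induction n with
  | zero => simp
  | succ n ih =>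
    have h1 : (Y.filter fun y => y + (n + 1) • h ∉ Y) ⊆
        (Y.filter fun y => y + n • h ∉ Y) ∪
          ((Y.filter fun y => y + h ∉ Y).image fun y => y - n • h) := by
      intro y hy
      rw [Finset.mem_filter] at hy
      rw [Finset.mem_union, Finset.mem_filter, Finset.mem_image]
      by_cases hn : y + n • h ∈ Y
      · right
        refine ⟨y + n • h, Finset.mem_filter.2 ⟨hn, ?_⟩, by abel⟩
        rw [add_assoc, ← succ_nsmul]
        exact hy.2
      · exact Or.inl ⟨hy.1, hn⟩
    calc _ ≤ _ := Finset.card_le_card h1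
      _ ≤ _ := Finset.card_union_le _ _
      _ ≤ n * (Y.filter fun y => y + h ∉ Y).card + (Y.filter fun y => y + h ∉ Y).card :=
        add_le_add ih Finset.card_image_le
      _ = _ := by ring

lemma card_filter_valMinAbs_le {ι : Type*} (A : Finset ι) (v : ι → ZMod p) (L N : ℕ)
    (hconc : ∀ c, (2 * L + 1) * (A.filter fun j => v j = c).card ≤ N) (c₀ : ZMod p) :
    (A.filter fun j => |(v j - c₀).valMinAbs| ≤ L).card ≤ N := by
  have h1 : ∀ j ∈ A.filter fun j => |(v j - c₀).valMinAbs| ≤ L,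
      (v j - c₀).valMinAbs ∈ Finset.Icc (-(L : ℤ)) L := by
    intro j hj
    rw [Finset.mem_Icc, ← abs_le]
    exact (Finset.mem_filter.1 hj).2
  have hcard : (Finset.Icc (-(L : ℤ)) L).card = 2 * L + 1 := by
    rw [Int.card_Icc, show (L : ℤ) + 1 - -L = ((2 * L + 1 : ℕ) : ℤ) by push_cast; ring, Int.toNat_natCast]
  refine Nat.le_of_mul_le_mul_left (c := 2 * L + 1) ?_ (Nat.succ_pos _)
  rw [Finset.card_eq_sum_card_fiberwise h1, Finset.mul_sum]
  calc _ ≤ ∑ c ∈ Finset.Icc (-(L : ℤ)) L, N := by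
        refine Finset.sum_le_sum fun c _ => le_trans ?_ (hconc (c₀ + c))
        refine Nat.mul_le_mul_left _ (Finset.card_le_card fun j hj => ?_)
        rw [Finset.mem_filter, Finset.mem_filter] at hj
        rw [Finset.mem_filter, ← hj.2, ZMod.coe_valMinAbs]
        exact ⟨hj.1.1, by ring⟩
    _ = _ := by rw [Finset.sum_const, hcard, smul_eq_mul]

lemma two_mul_norm_sum_differences_le {ι : Type*} (A : Finset ι) (v : ι → ZMod p) (L J : ℕ)
    (hL : 0 < L) (hJ : 2 * p ≤ L * J)
    (hconc : ∀ c, 4 * (2 * L + 1) * (A.filter fun j => v j = c).card ≤ A.card) :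
    2 * ‖∑ i ∈ A, ∑ j ∈ A, ∑ n ∈ Finset.range J, ZMod.stdAddChar ((n : ZMod p) * (v j - v i))‖ ≤
      A.card * (A.card * J) := by
  have hinner : ∀ i ∈ A, ∑ j ∈ A,
      ‖∑ n ∈ Finset.range J, ZMod.stdAddChar ((n : ZMod p) * (v j - v i))‖ ≤ A.card * J / 2 := by
    intro i _
    have hb : ∀ j ∈ A, ‖∑ n ∈ Finset.range J, ZMod.stdAddChar ((n : ZMod p) * (v j - v i))‖ ≤
        (J : ℝ) / 4 + if |(v j - v i).valMinAbs| ≤ L then (J : ℝ) else 0 := by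
      intro j _
      split_ifs with h
      · refine (norm_sum_le _ _).trans ?_
        simp only [AddChar.norm_apply, Finset.sum_const, Finset.card_range, nsmul_eq_mul, mul_one]
        have : (0 : ℝ) ≤ J := Nat.cast_nonneg J
        linarith
      · have h1 := norm_sum_range_stdAddChar_mul_le (v j - v i) J
        have h2 : (L : ℝ) ≤ |((v j - v i).valMinAbs : ℝ)| := by
          have : (L : ℤ) ≤ |(v j - v i).valMinAbs| := (not_le.1 h).le
          exact_mod_cast this
        have hJ' : (2 * p : ℝ) ≤ L * J := by exact_mod_cast hJ
        have hL' : (0 : ℝ) < L := by exact_mod_cast hL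
        set x := ‖∑ n ∈ Finset.range J, ZMod.stdAddChar ((n : ZMod p) * (v j - v i))‖
        have hx : 0 ≤ x := norm_nonneg _
        have h3 : x * (2 * L) ≤ L * J / 2 := by
          have := mul_le_mul_of_nonneg_left h2 hx
          nlinarith
        have h4 : L * (4 * x) ≤ L * J := by linarith
        have := le_of_mul_le_mul_left h4 hL'
        linarith
    refine (Finset.sum_le_sum hb).trans ?_
    rw [Finset.sum_add_distrib, Finset.sum_const, nsmul_eq_mul, ← Finset.sum_filter,
      Finset.sum_const, nsmul_eq_mul]
    have h5 := card_filter_valMinAbs_le A v L (A.card / 4) (fun c => by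
      rw [Nat.le_div_iff_mul_le (by norm_num)]
      refine le_trans (le_of_eq ?_) (hconc c)
      ring) (v i)
    have h6 : ((A.filter fun j => |(v j - v i).valMinAbs| ≤ L).card : ℝ) ≤ A.card / 4 :=
      (Nat.cast_le.2 h5).trans Nat.cast_div_le
    have : (0 : ℝ) ≤ J := Nat.cast_nonneg J
    nlinarith
  have h7 : ‖∑ i ∈ A, ∑ j ∈ A, ∑ n ∈ Finset.range J,
      ZMod.stdAddChar ((n : ZMod p) * (v j - v i))‖ ≤ ∑ i ∈ A, (A.card * J / 2 : ℝ) :=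
    (norm_sum_le _ _).trans (Finset.sum_le_sum fun i hi => (norm_sum_le _ _).trans (hinner i hi))
  rw [Finset.sum_const, nsmul_eq_mul] at h7
  linarith

/-- If no affine hyperplane contains a large proportion of a family, then every set of density at
most one half is expanded by a factor `1 + W / p` by some difference of the family. -/
lemma exists_difference_expanding {V : Type*} [AddCommGroup V] [Module (ZMod p) V] [Finite V]
    {ι : Type*} (A : Finset ι) (hA : A.Nonempty) (a : ι → V) (W : ℕ) (hW : 0 < W)
    (hp : 12 * W ≤ p)
    (hconc : ∀ u : Module.Dual (ZMod p) V, u ≠ 0 → ∀ c,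
      4 * (2 * (12 * W) + 1) * (A.filter fun j => u (a j) = c).card ≤ A.card)
    (Y : Finset V) (hY : 2 * Y.card ≤ Nat.card V) :
    ∃ i ∈ A, ∃ j ∈ A, W * Y.card ≤ p * (Y.filter fun y => y + (a j - a i) ∉ Y).card := by
  set J := 2 * p / (12 * W) + 1 with hJdef
  have hJ1 : 2 * p ≤ 12 * W * J := by
    have := Nat.lt_mul_div_succ (2 * p) (show 0 < 12 * W by omega)
    exact this.le
  have hJ2 : 12 * W * J ≤ 3 * p := by
    have := Nat.mul_div_le (2 * p) (12 * W)
    rw [hJdef, mul_add]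
    omega
  have hK : (A ×ˢ A ×ˢ Finset.range J).Nonempty :=
    hA.product (hA.product (Finset.nonempty_range_iff.2 (Nat.succ_ne_zero _)))
  obtain ⟨⟨i, j, n⟩, hk, hle⟩ := exists_card_inter_translate_le (A ×ˢ A ×ˢ Finset.range J) hK
    (fun k => k.2.2 • (a k.2.1 - a k.1)) (fun u hu => by
      have := two_mul_norm_sum_differences_le A (fun i => u (a i)) (12 * W) J (by omega) hJ1
        (hconc u hu)
      rw [Finset.sum_product]
      simp only [Finset.sum_product, Finset.card_product, Finset.card_range, map_nsmul, map_sub,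
        nsmul_eq_mul]
      push_cast
      exact this) Y hY
  simp only [Finset.mem_product, Finset.mem_range] at hk
  refine ⟨i, hk.1, j, hk.2.1, ?_⟩
  have h1 := card_moved_nsmul_le Y (a j - a i) n
  have h2 := Finset.card_filter_add_card_filter_not (s := Y) (fun y => y + n • (a j - a i) ∈ Y)
  simp only at hle
  set m := (Y.filter fun y => y + (a j - a i) ∉ Y).card
  have h3 : n * m ≤ J * m := Nat.mul_le_mul_right _ hk.2.2.le
  have h4 : Y.card ≤ 4 * (J * m) := by omega
  have h5 : 12 * (W * Y.card) ≤ 12 * (p * m) :=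
    calc 12 * (W * Y.card) = 12 * W * Y.card := by ring
      _ ≤ 12 * W * (4 * (J * m)) := Nat.mul_le_mul_left _ h4
      _ = 4 * (12 * W * J) * m := by ring
      _ ≤ 4 * (3 * p) * m := by gcongr
      _ = _ := by ring
  omega

end PairGrowth

section SubsetSums

variable {p : ℕ} {V : Type*} [AddCommGroup V] {ι : Type*}

/-- Every element of `Y` is a sum of exactly `n` terms of the family `a` with indices in `R`. -/
def Reaches (a : ι → V) (R : Finset ι) (n : ℕ) (Y : Finset V) : Prop :=
  ∀ y ∈ Y, ∃ I ⊆ R, I.card = n ∧ ∑ i ∈ I, a i = y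

lemma reaches_empty (a : ι → V) : Reaches a ∅ 0 {0} := by
  intro y hy
  exact ⟨∅, subset_rfl, rfl, (Finset.mem_singleton.1 hy).symm⟩

lemma reaches_image (a : ι → V) (J : Finset ι) : Reaches a J 1 (J.image a) := by
  intro y hy
  obtain ⟨j, hj, rfl⟩ := Finset.mem_image.1 hy
  exact ⟨{j}, by simpa using hj, by simp, by simp⟩

open scoped Pointwise in
lemma Reaches.add {a : ι → V} {R₁ R₂ : Finset ι} {n₁ n₂ : ℕ} {Y₁ Y₂ : Finset V}
    (h₁ : Reaches a R₁ n₁ Y₁) (h₂ : Reaches a R₂ n₂ Y₂) (hd : Disjoint R₁ R₂) :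
    Reaches a (R₁ ∪ R₂) (n₁ + n₂) (Y₁ + Y₂) := by
  intro y hy
  obtain ⟨y₁, hy₁, y₂, hy₂, rfl⟩ := Finset.mem_add.1 hy
  obtain ⟨I₁, hI₁, hc₁, rfl⟩ := h₁ y₁ hy₁
  obtain ⟨I₂, hI₂, hc₂, rfl⟩ := h₂ y₂ hy₂
  have hd' : Disjoint I₁ I₂ := Finset.disjoint_of_subset_left hI₁
    (Finset.disjoint_of_subset_right hI₂ hd)
  exact ⟨I₁ ∪ I₂, Finset.union_subset_union hI₁ hI₂,
    by rw [Finset.card_union_of_disjoint hd', hc₁, hc₂], Finset.sum_union hd'⟩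

lemma card_filter_sdiff_le (A R : Finset ι) (P : ι → Prop) [DecidablePred P] :
    ((A \ R).filter P).card ≤ (A.filter P).card :=
  Finset.card_le_card (Finset.filter_subset_filter _ Finset.sdiff_subset)

open scoped Pointwise in
lemma card_add_card_moved_le (Y : Finset V) (x y : V) :
    Y.card + (Y.filter fun v => v + (y - x) ∉ Y).card ≤ (({x, y} : Finset V) + Y).card := by
  set D := Y.filter fun v => v + (y - x) ∉ Y
  have h1 : (Y.image (x + ·)).card = Y.card := Finset.card_image_of_injective _ (add_right_injective x)
  have h2 : (D.image (y + ·)).card = D.card := Finset.card_image_of_injective _ (add_right_injective y)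
  rw [← h1, ← h2, ← Finset.card_union_of_disjoint]
  · refine Finset.card_le_card (Finset.union_subset ?_ ?_)
    · intro v hv
      obtain ⟨w, hw, rfl⟩ := Finset.mem_image.1 hv
      exact Finset.add_mem_add (by simp) hw
    · intro v hv
      obtain ⟨w, hw, rfl⟩ := Finset.mem_image.1 hv
      exact Finset.add_mem_add (by simp) (Finset.filter_subset _ _ hw)
  · rw [Finset.disjoint_left]
    intro v hv hv'
    obtain ⟨w, hw, rfl⟩ := Finset.mem_image.1 hv
    obtain ⟨w', hw', h⟩ := Finset.mem_image.1 hv'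
    refine (Finset.mem_filter.1 hw').2 ?_
    have : w' + (y - x) = w := by
      have h : y + w' = x + w := h
      rw [add_sub_assoc', add_comm w' y, h, add_sub_cancel_left]
    rwa [this]

variable [Fact p.Prime] [Module (ZMod p) V] [Finite V]

lemma exists_small_affine_spanning (A : Finset ι) (hA : A.Nonempty) (a : ι → V)
    (hspan : ∀ u : Module.Dual (ZMod p) V, u ≠ 0 → ∀ c,
      (A.filter fun j => u (a j) = c).card < A.card) :
    ∃ J ⊆ A, J.Nonempty ∧ J.card ≤ Module.finrank (ZMod p) V + 1 ∧
      AddSubgroup.closure {v : V | ∃ b ∈ J.image a, ∃ b' ∈ J.image a, v = b - b'} = ⊤ := by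
  obtain ⟨i₀, hi₀⟩ := hA
  set s : Set V := Set.image (fun i => a i - a i₀) A with hs
  have htop : Submodule.span (ZMod p) s = ⊤ := by
    by_contra hne
    obtain ⟨u, hu, hle⟩ := Submodule.exists_le_ker_of_lt_top _ (lt_top_iff_ne_top.2 hne)
    refine (hspan u hu (u (a i₀))).ne ?_
    rw [Finset.filter_true_of_mem]
    intro j hj
    have : a j - a i₀ ∈ LinearMap.ker u := hle (Submodule.subset_span ⟨j, hj, rfl⟩)
    rwa [LinearMap.mem_ker, map_sub, sub_eq_zero] at this
  obtain ⟨b, hbs, hbspan, hbli⟩ := exists_linearIndependent (ZMod p) s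
  have : Fintype b := Fintype.ofFinite _
  have hbcard : b.toFinset.card ≤ Module.finrank (ZMod p) V := by
    rw [Set.toFinset_card]
    exact hbli.fintype_card_le_finrank
  have hbs' : ∀ x : V, ∃ i, x ∈ b → i ∈ A ∧ a i - a i₀ = x := by
    intro x
    by_cases hx : x ∈ b
    · obtain ⟨i, hi, h⟩ := hbs hx
      exact ⟨i, fun _ => ⟨hi, h⟩⟩
    · exact ⟨i₀, fun h => absurd h hx⟩
  choose f hf using hbs'
  refine ⟨insert i₀ (b.toFinset.image f), ?_, Finset.insert_nonempty _ _, ?_, ?_⟩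
  · intro i hi
    rcases Finset.mem_insert.1 hi with rfl | hi
    · exact hi₀
    · obtain ⟨x, hx, rfl⟩ := Finset.mem_image.1 hi
      exact (hf x (Set.mem_toFinset.1 hx)).1
  · exact (Finset.card_insert_le _ _).trans
      (Nat.succ_le_succ (Finset.card_image_le.trans hbcard))
  · set H := AddSubgroup.closure {v : V | ∃ x ∈ (insert i₀ (b.toFinset.image f)).image a,
      ∃ x' ∈ (insert i₀ (b.toFinset.image f)).image a, v = x - x'} with hH
    have hle : Submodule.span (ZMod p) b ≤ AddSubgroup.toZModSubmodule p H := by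
      rw [Submodule.span_le]
      intro x hx
      refine AddSubgroup.subset_closure ⟨a (f x), ?_, a i₀, ?_, (hf x hx).2.symm⟩
      · exact Finset.mem_image_of_mem _ (Finset.mem_insert_of_mem
          (Finset.mem_image_of_mem _ (Set.mem_toFinset.2 hx)))
      · exact Finset.mem_image_of_mem _ (Finset.mem_insert_self _ _)
    rw [hbspan, htop] at hle
    rw [eq_top_iff]
    intro x _
    exact hle (Submodule.mem_top (x := x))

lemma exists_reaches_unisolvent (A : Finset ι) (a : ι → V) (k : ℕ)
    (hV : 0 < Module.finrank (ZMod p) V)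
    (hspan : ∀ u : Module.Dual (ZMod p) V, u ≠ 0 → ∀ c,
      (A.filter fun j => u (a j) = c).card + (Module.finrank (ZMod p) V + 1) * k < A.card) :
    ∃ R ⊆ A, R.card ≤ (Module.finrank (ZMod p) V + 1) * k ∧
      ∃ Y, Reaches a R k Y ∧ Unisolvent p k Y := by
  induction k with
  | zero => exact ⟨∅, by simp, by simp, {0}, reaches_empty a, unisolvent_zero 0⟩
  | succ k ih =>
    obtain ⟨R, hRA, hR, Y, hY, hYu⟩ := ih fun u hu c => by
      have := hspan u hu c
      rw [mul_add] at this
      omega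
    have hcard : (A \ R).card = A.card - R.card := Finset.card_sdiff_of_subset hRA
    have hspan' : ∀ u : Module.Dual (ZMod p) V, u ≠ 0 → ∀ c,
        ((A \ R).filter fun j => u (a j) = c).card < (A \ R).card := by
      intro u hu c
      have h1 := hspan u hu c
      have h2 := card_filter_sdiff_le A R fun j => u (a j) = c
      rw [mul_add] at h1
      omega
    have hne : (A \ R).Nonempty := by
      have : Nontrivial V := Module.nontrivial_of_finrank_pos hV
      obtain ⟨u, hu⟩ := exists_ne (0 : Module.Dual (ZMod p) V)
      exact Finset.card_pos.1 ((Nat.zero_le _).trans_lt (hspan' u hu 0))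
    obtain ⟨J, hJA, hJne, hJ, hcl⟩ := exists_small_affine_spanning (A \ R) hne a hspan'
    refine ⟨J ∪ R, Finset.union_subset (hJA.trans Finset.sdiff_subset) hRA, ?_, _,
      add_comm 1 k ▸ (reaches_image a J).add hY ?_, hYu.add hcl (hJne.image a)⟩
    · have := Finset.card_union_le J R
      rw [mul_add]
      omega
    · exact Finset.disjoint_of_subset_left hJA Finset.sdiff_disjoint

lemma exists_reaches_growth (A : Finset ι) (a : ι → V) (W : ℕ) (hW : 0 < W) (hp : 12 * W ≤ p)
    {R₀ : Finset ι} (hR₀ : R₀ ⊆ A) {n₀ : ℕ} {Y₀ : Finset V} (hY₀ : Reaches a R₀ n₀ Y₀)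
    (hne : Y₀.Nonempty) (k : ℕ) (hk : R₀.card + 2 * k < A.card)
    (hconc : ∀ u : Module.Dual (ZMod p) V, u ≠ 0 → ∀ c,
      4 * (2 * (12 * W) + 1) * (A.filter fun j => u (a j) = c).card + R₀.card + 2 * k ≤ A.card) :
    ∃ R ⊆ A, R.card ≤ R₀.card + 2 * k ∧ ∃ n ≤ n₀ + k, ∃ Y, Reaches a R n Y ∧
      (Nat.card V < 2 * Y.card ∨ (p + k * W) * Y₀.card ≤ p * Y.card) := by
  induction k with
  | zero => exact ⟨R₀, hR₀, by simp, n₀, by simp, Y₀, hY₀, Or.inr (by simp)⟩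
  | succ k ih =>
    obtain ⟨R, hRA, hR, n, hn, Y, hY, hor⟩ := ih (by omega) fun u hu c => by
      have := hconc u hu c
      omega
    by_cases hbig : Nat.card V < 2 * Y.card
    · exact ⟨R, hRA, by omega, n, by omega, Y, hY, Or.inl hbig⟩
    have hgrow := hor.resolve_left hbig
    have hcard : (A \ R).card = A.card - R.card := Finset.card_sdiff_of_subset hRA
    have hne' : (A \ R).Nonempty := by
      rw [← Finset.card_pos]
      omega
    have hp0 : 0 < p := (Fact.out : p.Prime).pos
    have hYY : Y₀.card ≤ Y.card := by
      refine Nat.le_of_mul_le_mul_left (le_trans ?_ hgrow) hp0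
      exact Nat.mul_le_mul_right _ (Nat.le_add_right _ _)
    have hY0 := hne.card_pos
    obtain ⟨i, hi, j, hj, hij⟩ := exists_difference_expanding (A \ R) hne' a W hW hp
      (fun u hu c => by
        have h1 := hconc u hu c
        have h2 := Nat.mul_le_mul_left (4 * (2 * (12 * W) + 1))
          (card_filter_sdiff_le A R fun j => u (a j) = c)
        omega) Y (not_lt.1 hbig)
    refine ⟨{i, j} ∪ R, Finset.union_subset ?_ hRA, ?_, 1 + n, by omega, _,
      (reaches_image a {i, j}).add hY ?_, Or.inr ?_⟩
    · intro x hx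
      rcases Finset.mem_insert.1 hx with rfl | hx
      · exact Finset.sdiff_subset hi
      · rw [Finset.mem_singleton.1 hx]
        exact Finset.sdiff_subset hj
    · have := Finset.card_union_le {i, j} R
      have := Finset.card_le_two (a := i) (b := j)
      omega
    · rw [Finset.disjoint_left]
      intro x hx
      rcases Finset.mem_insert.1 hx with rfl | hx
      · exact (Finset.mem_sdiff.1 hi).2
      · rw [Finset.mem_singleton.1 hx]
        exact (Finset.mem_sdiff.1 hj).2
    · have h1 := card_add_card_moved_le Y (a i) (a j)
      rw [Finset.image_insert, Finset.image_singleton]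
      have h2 := Nat.mul_le_mul_left p h1
      have h3 := Nat.mul_le_mul_left W hYY
      calc (p + (k + 1) * W) * Y₀.card = (p + k * W) * Y₀.card + W * Y₀.card := by ring
        _ ≤ p * Y.card + W * Y.card := add_le_add hgrow h3
        _ ≤ _ := by rw [mul_add] at h2; omega

end SubsetSums

section ZeroSum

variable {p : ℕ} [Fact p.Prime] {V : Type*} [AddCommGroup V] [Module (ZMod p) V] [Finite V]
  {ι : Type*}

/-- The expansion factor needed in dimension `d`. -/
def expansionFactor (d : ℕ) : ℕ := 16 * (8 * d) ^ d

lemma exists_reaches_half (A : Finset ι) (a : ι → V) {d : ℕ} (hd : 0 < d)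
    (hV : Module.finrank (ZMod p) V = d) (hp8 : 8 ≤ p) (hp : 12 * expansionFactor d ≤ p)
    (hA : (d + 1) * p < A.card)
    (hconc : ∀ u : Module.Dual (ZMod p) V, u ≠ 0 → ∀ c,
      4 * (2 * (12 * expansionFactor d) + 1) * (A.filter fun j => u (a j) = c).card +
        (d + 1) * p < A.card) :
    ∃ R ⊆ A, R.card ≤ (d + 1) * p ∧ ∃ n, 2 * n ≤ p ∧ ∃ Y, Reaches a R n Y ∧
      Nat.card V < 2 * Y.card := by
  set W := expansionFactor d with hWdef
  have hW : 0 < W := by rw [hWdef, expansionFactor]; positivity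
  have hp0 : 0 < p := by omega
  set m := p / (8 * d) with hm
  set k := p / 8 with hk
  have hdm : 8 * (d * m) ≤ p := by
    have := Nat.mul_div_le p (8 * d)
    rwa [← hm, mul_assoc] at this
  have hmp : m < p := Nat.div_lt_self hp0 (by omega)
  have hpm : p ≤ 8 * d * (m + 1) := (Nat.lt_mul_div_succ p (by omega)).le
  have hslots : (d + 1) * (d * m) + 2 * k ≤ (d + 1) * p := by
    have h1 : (d + 1) * (8 * (d * m)) ≤ (d + 1) * p := Nat.mul_le_mul_left _ hdm
    have h2 : 1 * p ≤ (d + 1) * p := Nat.mul_le_mul_right _ (by omega)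
    have h3 : (d + 1) * (8 * (d * m)) = 8 * ((d + 1) * (d * m)) := by ring
    omega
  obtain ⟨R₀, hR₀A, hR₀, Y₀, hY₀, hY₀u⟩ := exists_reaches_unisolvent A a (d * m) (hV ▸ hd)
    fun u hu c => by
      rw [hV]
      have h1 := hconc u hu c
      have h2 : 1 * (A.filter fun j => u (a j) = c).card ≤
        4 * (2 * (12 * W) + 1) * (A.filter fun j => u (a j) = c).card :=
        Nat.mul_le_mul_right _ (by omega)
      omega
  rw [hV] at hR₀
  have hY₀card : (m + 1) ^ d ≤ Y₀.card :=
    hY₀u.pow_le_card (Module.finBasisOfFinrankEq (ZMod p) V hV) hmp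
  have hVcard : Nat.card V = p ^ d := by
    rw [Module.natCard_eq_pow_finrank (K := ZMod p), Nat.card_zmod, hV]
  have hcover : Nat.card V ≤ (8 * d) ^ d * Y₀.card := by
    rw [hVcard]
    calc p ^ d ≤ (8 * d * (m + 1)) ^ d := Nat.pow_le_pow_left hpm d
      _ = (8 * d) ^ d * (m + 1) ^ d := mul_pow _ _ _
      _ ≤ _ := Nat.mul_le_mul_left _ hY₀card
  obtain ⟨R, hRA, hR, n, hn, Y, hY, hor⟩ := exists_reaches_growth A a W hW hp hR₀A hY₀
    hY₀u.nonempty k (by omega) fun u hu c => by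
      have := hconc u hu c
      omega
  refine ⟨R, hRA, by omega, n, by omega, Y, hY, hor.elim id fun h => ?_⟩
  exfalso
  have hk16 : p ≤ 16 * k := by omega
  have hYV : Y.card ≤ Nat.card V := by
    have : Fintype V := Fintype.ofFinite V
    rw [Nat.card_eq_fintype_card]
    exact Finset.card_le_univ Y
  have h1 : p * Nat.card V ≤ k * W * Y₀.card :=
    calc p * Nat.card V ≤ 16 * k * ((8 * d) ^ d * Y₀.card) := Nat.mul_le_mul hk16 hcover
      _ = k * W * Y₀.card := by rw [hWdef, expansionFactor]; ring
  have h2 : 0 < p * Y₀.card := Nat.mul_pos hp0 hY₀u.nonempty.card_pos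
  have h3 : p * Y.card ≤ p * Nat.card V := Nat.mul_le_mul_left _ hYV
  rw [add_mul] at h
  omega

lemma exists_add_eq_of_card {Y₁ Y₂ : Finset V} (h₁ : Nat.card V < 2 * Y₁.card)
    (h₂ : Nat.card V < 2 * Y₂.card) (g : V) : ∃ y₁ ∈ Y₁, ∃ y₂ ∈ Y₂, y₁ + y₂ = g := by
  have : Fintype V := Fintype.ofFinite V
  have h3 : (Y₂.image (g - ·)).card = Y₂.card :=
    Finset.card_image_of_injective _ sub_right_injective
  have h4 : (Finset.univ : Finset V).card < Y₁.card + (Y₂.image (g - ·)).card := by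
    rw [h3, Finset.card_univ, ← Nat.card_eq_fintype_card]
    omega
  obtain ⟨y, hy⟩ := Finset.inter_nonempty_of_card_lt_card_add_card
    (Finset.subset_univ _) (Finset.subset_univ _) h4
  rw [Finset.mem_inter] at hy
  obtain ⟨z, hz, rfl⟩ := Finset.mem_image.1 hy.2
  exact ⟨_, hy.1, z, hz, sub_add_cancel g z⟩

/-- A long sequence without concentration on affine hyperplanes has a zero-sum subsequence of
length `p`. -/
lemma exists_zero_sum_of_not_concentrated (A : Finset ι) (a : ι → V) {d : ℕ} (hd : 0 < d)
    (hV : Module.finrank (ZMod p) V = d) (hp8 : 8 ≤ p) (hp : 12 * expansionFactor d ≤ p)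
    (hA : (2 * (d + 1) + 1) * p < A.card)
    (hconc : ∀ u : Module.Dual (ZMod p) V, u ≠ 0 → ∀ c,
      4 * (2 * (12 * expansionFactor d) + 1) * (A.filter fun j => u (a j) = c).card +
        2 * (d + 1) * p < A.card) :
    ∃ I ⊆ A, I.card = p ∧ ∑ i ∈ I, a i = 0 := by
  have e1 : 2 * (d + 1) * p = 2 * ((d + 1) * p) := by ring
  have e2 : (2 * (d + 1) + 1) * p = 2 * ((d + 1) * p) + p := by ring
  obtain ⟨R₁, hR₁A, hR₁, n₁, hn₁, Y₁, hY₁, hc₁⟩ := exists_reaches_half A a hd hV hp8 hp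
    (by omega) fun u hu c => by
      have := hconc u hu c
      omega
  have hcard₁ : (A \ R₁).card = A.card - R₁.card := Finset.card_sdiff_of_subset hR₁A
  obtain ⟨R₂, hR₂A, hR₂, n₂, hn₂, Y₂, hY₂, hc₂⟩ := exists_reaches_half (A \ R₁) a hd hV hp8 hp
    (by omega) fun u hu c => by
      have h1 := hconc u hu c
      have h2 := Nat.mul_le_mul_left (4 * (2 * (12 * expansionFactor d) + 1))
        (card_filter_sdiff_le A R₁ fun j => u (a j) = c)
      omega
  have hdisj : Disjoint R₁ R₂ :=
    Finset.disjoint_of_subset_right hR₂A Finset.disjoint_sdiff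
  have hcard₂ : ((A \ R₁) \ R₂).card = (A \ R₁).card - R₂.card := Finset.card_sdiff_of_subset hR₂A
  obtain ⟨F, hFA, hF⟩ := Finset.exists_subset_card_eq
    (s := (A \ R₁) \ R₂) (n := p - n₁ - n₂) (by omega)
  obtain ⟨y₁, hy₁, y₂, hy₂, hsum⟩ := exists_add_eq_of_card hc₁ hc₂ (-∑ i ∈ F, a i)
  obtain ⟨I, hI, hIc, hIs⟩ := hY₁.add hY₂ hdisj _ (Finset.add_mem_add hy₁ hy₂)
  have hdF : Disjoint I F := by
    rw [Finset.disjoint_left]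
    intro x hx hxF
    have h1 := hFA hxF
    rw [Finset.mem_sdiff, Finset.mem_sdiff] at h1
    rcases Finset.mem_union.1 (hI hx) with h | h
    · exact h1.1.2 h
    · exact h1.2 h
  refine ⟨I ∪ F, Finset.union_subset (hI.trans (Finset.union_subset hR₁A
    (hR₂A.trans Finset.sdiff_subset))) (hFA.trans (Finset.sdiff_subset.trans
    Finset.sdiff_subset)), ?_, ?_⟩
  · rw [Finset.card_union_of_disjoint hdF, hIc, hF]
    omega
  · rw [Finset.sum_union hdF, hIs, hsum, neg_add_cancel]

lemma exists_zero_sum_of_card_mul_le (A : Finset ι) (a : ι → V) (h : Nat.card V * p ≤ A.card) :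
    ∃ I ⊆ A, I.card = p ∧ ∑ i ∈ I, a i = 0 := by
  have : Fintype V := Fintype.ofFinite V
  obtain ⟨y, -, hy⟩ := Finset.exists_le_card_fiber_of_mul_le_card_of_maps_to
    (s := A) (t := Finset.univ) (f := a) (n := p) (fun _ _ => Finset.mem_univ _)
    ⟨0, Finset.mem_univ _⟩ (by rwa [Finset.card_univ, ← Nat.card_eq_fintype_card])
  obtain ⟨I, hI, hIc⟩ := Finset.exists_subset_card_eq hy
  refine ⟨I, hI.trans (Finset.filter_subset _ _), hIc, ?_⟩
  rw [Finset.sum_congr rfl fun i hi => (Finset.mem_filter.1 (hI hi)).2, Finset.sum_const, hIc,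
    ← Nat.cast_smul_eq_nsmul (ZMod p), CharP.cast_eq_zero, zero_smul]

end ZeroSum

/-- **Alon–Dubiner**: a sequence of length at least `C p` over an elementary abelian `p`-group of
rank at most `d` has a zero-sum subsequence of length exactly `p`, where `C` depends only on `d`. -/
theorem exists_zero_sum_subsequence_length_prime (d : ℕ) :
    ∃ C : ℕ, 0 < C ∧ ∀ (p : ℕ) [Fact p.Prime] (V : Type*) [AddCommGroup V] [Module (ZMod p) V]
      [Finite V], Module.finrank (ZMod p) V ≤ d →
      ∀ {ι : Type*} (A : Finset ι) (a : ι → V), C * p ≤ A.card →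
        ∃ I ⊆ A, I.card = p ∧ ∑ i ∈ I, a i = 0 := by
  induction d with
  | zero =>
    refine ⟨1, one_pos, fun p _ V _ _ _ hV ι A a hA => exists_zero_sum_of_card_mul_le A a ?_⟩
    rw [Module.natCard_eq_pow_finrank (K := ZMod p), Nat.le_zero.1 hV, pow_zero]
    exact hA
  | succ d ih =>
    obtain ⟨C₀, hC₀, ih⟩ := ih
    set W := expansionFactor (d + 1) with hW
    have hW16 : 16 ≤ W := by
      have : 0 < (8 * (d + 1)) ^ (d + 1) := by positivity
      rw [hW, expansionFactor]
      omega
    set M := 4 * (2 * (12 * W) + 1) with hM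
    refine ⟨M * C₀ + 2 * (d + 2) + 2 + (12 * W) ^ (d + 1), by positivity,
      fun p _ V _ _ _ hV ι A a hA => ?_⟩
    have hp0 : 0 < p := (Fact.out : p.Prime).pos
    have hexp : (M * C₀ + 2 * (d + 2) + 2 + (12 * W) ^ (d + 1)) * p =
        M * (C₀ * p) + 2 * (d + 2) * p + 2 * p + (12 * W) ^ (d + 1) * p := by ring
    rcases hV.lt_or_eq with hlt | hV
    · refine ih p V (Nat.lt_succ_iff.1 hlt) A a ?_
      have : 1 * (C₀ * p) ≤ M * (C₀ * p) := Nat.mul_le_mul_right _ (by omega)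
      omega
    rcases lt_or_ge p (12 * W) with hsmall | hlarge
    · refine exists_zero_sum_of_card_mul_le A a ?_
      rw [Module.natCard_eq_pow_finrank (K := ZMod p), hV, Nat.card_zmod]
      have := Nat.mul_le_mul_right p (Nat.pow_le_pow_left hsmall.le (d + 1))
      omega
    by_cases hconc : ∃ u : Module.Dual (ZMod p) V, u ≠ 0 ∧ ∃ c,
      C₀ * p ≤ (A.filter fun j => u (a j) = c).card
    · obtain ⟨u, hu, c, hc⟩ := hconc
      obtain ⟨i₀, hi₀⟩ : (A.filter fun j => u (a j) = c).Nonempty :=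
        Finset.card_pos.1 ((Nat.mul_pos hC₀ hp0).trans_le hc)
      have hker : Module.finrank (ZMod p) (LinearMap.ker u) ≤ d := by
        have := Module.Dual.finrank_ker_add_one_of_ne_zero hu
        omega
      let a' : ι → LinearMap.ker u := fun i =>
        if h : a i - a i₀ ∈ LinearMap.ker u then ⟨a i - a i₀, h⟩ else 0
      obtain ⟨I, hI, hIc, hIs⟩ := ih p (LinearMap.ker u) hker _ a' hc
      refine ⟨I, hI.trans (Finset.filter_subset _ _), hIc, ?_⟩
      have h1 : ∀ i ∈ I, (a' i : V) = a i - a i₀ := by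
        intro i hi
        have h2 : a i - a i₀ ∈ LinearMap.ker u := by
          rw [LinearMap.mem_ker, map_sub, (Finset.mem_filter.1 (hI hi)).2,
            (Finset.mem_filter.1 hi₀).2, sub_self]
        simp only [a', dif_pos h2]
      have h3 : ∑ i ∈ I, (a' i : V) = 0 := by
        rw [← Submodule.coe_sum, hIs, Submodule.coe_zero]
      rw [Finset.sum_congr rfl h1, Finset.sum_sub_distrib, Finset.sum_const, hIc,
        ← Nat.cast_smul_eq_nsmul (ZMod p), CharP.cast_eq_zero, zero_smul, sub_zero] at h3
      exact h3
    · push Not at hconc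
      have e2 : (2 * (d + 1 + 1) + 1) * p = 2 * (d + 2) * p + p := by ring
      refine exists_zero_sum_of_not_concentrated A a (d := d + 1) (by omega) hV (by omega) hlarge
        (by omega) fun u hu c => ?_
      have h1 := Nat.mul_le_mul_left M (hconc u hu c).le
      have e3 : 2 * (d + 1 + 1) * p = 2 * (d + 2) * p := by ring
      change M * _ + _ < _
      omega

lemma IsZeroSumFree.cons_sum_sub {G : Type*} [AddCommGroup G] {S T : Multiset G}
    (hS : IsZeroSumFree S) (hT : T ≤ S) (hT0 : T ≠ 0) : IsZeroSumFree (T.sum ::ₘ (S - T)) := by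
  intro U hU hU0
  by_cases hmem : T.sum ∈ U
  · obtain ⟨U', rfl⟩ := Multiset.exists_cons_of_mem hmem
    rw [Multiset.cons_le_cons_iff] at hU
    have h1 : T + U' ≤ S := (add_le_add_right hU T).trans (add_tsub_cancel_of_le hT).le
    have h2 := hS (T + U') h1 fun h => hT0 (add_eq_zero.1 h).1
    rwa [Multiset.sum_add, ← Multiset.sum_cons] at h2
  · rw [Multiset.le_cons_of_notMem hmem] at hU
    exact hS U (hU.trans tsub_le_self) hU0

lemma crossNumber_add {G : Type*} [AddCommGroup G] (S T : Multiset G) :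
    crossNumber (S + T) = crossNumber S + crossNumber T := by
  simp [crossNumber]

lemma crossNumber_cons {G : Type*} [AddCommGroup G] (g : G) (S : Multiset G) :
    crossNumber (g ::ₘ S) = 1 / addOrderOf g + crossNumber S := by
  simp [crossNumber]

lemma crossNumber_of_addOrderOf_eq {G : Type*} [AddCommGroup G] {S : Multiset G} {d : ℕ}
    (h : ∀ g ∈ S, addOrderOf g = d) : crossNumber S = Multiset.card S / d := by
  rw [crossNumber, Multiset.map_congr rfl fun g hg => by rw [h g hg], Multiset.map_const',
    Multiset.sum_replicate, nsmul_eq_mul, mul_one_div]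

lemma finrank_le_of_natCard_le {p : ℕ} [Fact p.Prime] {V : Type*} [AddCommGroup V]
    [Module (ZMod p) V] [Finite V] {r : ℕ} (h : Nat.card V ≤ p ^ r) :
    Module.finrank (ZMod p) V ≤ r := by
  rw [Module.natCard_eq_pow_finrank (K := ZMod p), Nat.card_zmod] at h
  exact (Nat.pow_le_pow_iff_right (Fact.out : p.Prime).one_lt).1 h

/-- A long sequence of elements killed by `d` has a subsequence of length `p` whose sum is killed
by `d / p`. -/
theorem exists_le_card_eq_nsmul_sum_eq_zero (r : ℕ) :
    ∃ C : ℕ, 0 < C ∧ ∀ (G : Type*) [AddCommGroup G] [Finite G],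
      (∀ p : ℕ, p.Prime → Nat.card (nsmulAddMonoidHom (α := G) p).ker ≤ p ^ r) →
      ∀ p d : ℕ, p.Prime → p ∣ d → ∀ S : Multiset G, (∀ g ∈ S, d • g = 0) →
        C * p ≤ Multiset.card S → ∃ T ≤ S, Multiset.card T = p ∧ (d / p) • T.sum = 0 := by
  obtain ⟨C, hC, h⟩ := exists_zero_sum_subsequence_length_prime r
  refine ⟨C, hC, fun G _ _ hG p d hp hpd S hS hcard => ?_⟩
  have : Fact p.Prime := ⟨hp⟩
  let V := (nsmulAddMonoidHom (α := G) p).ker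
  let _ : Module (ZMod p) V := AddCommGroup.zmodModule fun x => Subtype.ext x.2
  have hrank : Module.finrank (ZMod p) V ≤ r := finrank_le_of_natCard_le (hG p hp)
  induction S using Quotient.inductionOn with | _ l
  let a : Fin l.length → V := fun i => ⟨(d / p) • l.get i, by
    rw [AddMonoidHom.mem_ker, nsmulAddMonoidHom_apply, smul_smul, Nat.mul_div_cancel' hpd]
    exact hS _ (l.get_mem i)⟩
  obtain ⟨I, -, hIc, hIs⟩ := h p V hrank Finset.univ a (by simpa using hcard)
  refine ⟨I.val.map l.get, ?_, by simpa using hIc, ?_⟩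
  · have h1 := Multiset.map_le_map (f := l.get) (Finset.val_le_iff.2 (Finset.subset_univ I))
    rwa [Fin.univ_val_map, List.ofFn_get] at h1
  · have h1 := congrArg (fun x : V => (x : G)) hIs
    simp only [AddSubgroup.val_finsetSum, AddSubgroup.coe_zero, a] at h1
    rw [← Finset.smul_sum] at h1
    exact h1

/-- Every zero-sumfree sequence can be compressed, without decreasing its cross number, to one
with few elements of each order. -/
lemma IsZeroSumFree.exists_card_filter_addOrderOf_lt {G : Type*} [AddCommGroup G] {C : ℕ}
    (hC : ∀ p d : ℕ, p.Prime → p ∣ d → ∀ S : Multiset G, (∀ g ∈ S, d • g = 0) →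
      C * p ≤ Multiset.card S → ∃ T ≤ S, Multiset.card T = p ∧ (d / p) • T.sum = 0)
    {S : Multiset G} (hS : IsZeroSumFree S) :
    ∃ S' : Multiset G, IsZeroSumFree S' ∧ crossNumber S ≤ crossNumber S' ∧
      ∀ d, 1 < d → Multiset.card (S'.filter fun g => addOrderOf g = d) < C * d.minFac := by
  induction hk : Multiset.card S using Nat.strong_induction_on generalizing S with | _ k ih
  by_cases hlt : ∀ d, 1 < d → Multiset.card (S.filter fun g => addOrderOf g = d) < C * d.minFac
  · exact ⟨S, hS, le_rfl, hlt⟩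
  push Not at hlt
  obtain ⟨d, hd, hcard⟩ := hlt
  have hp : d.minFac.Prime := Nat.minFac_prime hd.ne'
  have hord : ∀ g ∈ S.filter fun g => addOrderOf g = d, addOrderOf g = d := fun g hg =>
    (Multiset.mem_filter.1 hg).2
  obtain ⟨T, hTle, hTc, hTs⟩ := hC d.minFac d hp d.minFac_dvd _
    (fun g hg => by rw [← hord g hg]; exact addOrderOf_nsmul_eq_zero g) hcard
  have hTS : T ≤ S := hTle.trans (Multiset.filter_le _ _)
  have hT0 : T ≠ 0 := by
    rintro rfl
    exact hp.ne_zero hTc.symm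
  have hcard' : Multiset.card (T.sum ::ₘ (S - T)) < k := by
    have h1 := Multiset.card_le_card hTS
    have h2 := hp.two_le
    rw [Multiset.card_cons, Multiset.card_sub hTS]
    omega
  obtain ⟨S', hS', hle, hlt⟩ := ih _ hcard' (hS.cons_sum_sub hTS hT0) rfl
  refine ⟨S', hS', le_trans ?_ hle, hlt⟩
  conv_lhs => rw [← tsub_add_cancel_of_le hTS]
  rw [crossNumber_add, crossNumber_cons, add_comm (crossNumber _) (crossNumber T),
    crossNumber_of_addOrderOf_eq fun g hg => hord g (Multiset.mem_of_le hTle hg), hTc]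
  have hq : 0 < d / d.minFac := Nat.div_pos (Nat.minFac_le (by omega)) hp.pos
  have h1 : addOrderOf T.sum ≤ d / d.minFac :=
    Nat.le_of_dvd hq (addOrderOf_dvd_of_nsmul_eq_zero hTs)
  have h0 : 0 < addOrderOf T.sum :=
    Nat.pos_of_dvd_of_pos (addOrderOf_dvd_of_nsmul_eq_zero hTs) hq
  have h2 : addOrderOf T.sum * d.minFac ≤ d :=
    (Nat.mul_le_mul_right _ h1).trans (Nat.div_mul_le_self _ _)
  refine add_le_add ?_ le_rfl
  rw [div_le_div_iff₀ (by positivity) (by positivity), one_mul, mul_comm]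
  exact_mod_cast h2

lemma crossNumber_eq_sum_divisors {G : Type*} [AddCommGroup G] {N : ℕ} (hN : N ≠ 0)
    {S : Multiset G} (h : ∀ g ∈ S, addOrderOf g ∣ N) :
    crossNumber S =
      ∑ d ∈ N.divisors, (Multiset.card (S.filter fun g => addOrderOf g = d) : ℝ) / d := by
  induction S using Multiset.induction with
  | empty => simp [crossNumber]
  | cons g S ih =>
    rw [crossNumber_cons, ih fun x hx => h x (Multiset.mem_cons_of_mem hx)]
    have hg : addOrderOf g ∈ N.divisors :=
      Nat.mem_divisors.2 ⟨h g (Multiset.mem_cons_self g S), hN⟩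
    rw [← Finset.sum_ite_eq N.divisors (addOrderOf g) (fun d : ℕ => (1 : ℝ) / d) |>.trans
      (if_pos hg), ← Finset.sum_add_distrib]
    refine Finset.sum_congr rfl fun d _ => ?_
    rw [Multiset.filter_cons]
    split_ifs <;> simp [add_div, add_comm]

theorem crossNumber_le_of_isZeroSumFree {G : Type*} [AddCommGroup G] {C N : ℕ}
    (hN : N ≠ 0) (hG : ∀ g : G, N • g = 0)
    (hC : ∀ p d : ℕ, p.Prime → p ∣ d → ∀ S : Multiset G, (∀ g ∈ S, d • g = 0) →
      C * p ≤ Multiset.card S → ∃ T ≤ S, Multiset.card T = p ∧ (d / p) • T.sum = 0)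
    {S : Multiset G} (hS : IsZeroSumFree S) :
    crossNumber S ≤ C * (4 * N.primeFactors.card) := by
  obtain ⟨S', hS', hle, hlt⟩ := hS.exists_card_filter_addOrderOf_lt hC
  refine hle.trans ?_
  rw [crossNumber_eq_sum_divisors hN fun g _ => addOrderOf_dvd_of_nsmul_eq_zero (hG g)]
  refine le_trans ?_ (mul_le_mul_of_nonneg_left (sum_minFacWeight_le N hN) C.cast_nonneg)
  rw [Finset.mul_sum]
  refine Finset.sum_le_sum fun d hd => ?_
  rw [minFacWeight]
  have hd0 : 0 < d := Nat.pos_of_mem_divisors hd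
  split_ifs with h1
  · have h2 : S'.filter (fun g => addOrderOf g = d) = 0 := by
      refine Multiset.filter_eq_nil.2 fun g hg hgd => ?_
      rw [h1, AddMonoid.addOrderOf_eq_one_iff] at hgd
      subst hgd
      exact hS' {0} (Multiset.singleton_le.2 hg) (Multiset.singleton_ne_zero _)
        (Multiset.sum_singleton _)
    simp [h2]
  · rw [← mul_div_assoc]
    gcongr
    exact_mod_cast (hlt d (by omega)).le

lemma card_ker_nsmul_pi_zmod_le {s : ℕ} (n : Fin s → ℕ) (hn : ∀ i, n i ≠ 0) {p : ℕ} (hp : 0 < p) :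
    Nat.card (nsmulAddMonoidHom (α := ∀ i : Fin s, ZMod (n i)) p).ker ≤ p ^ s := by
  have : ∀ i, NeZero (n i) := fun i => ⟨hn i⟩
  let K : Fin s → Type := fun i => {x : ZMod (n i) // p • x = 0}
  have hK : ∀ i, Nat.card (K i) ≤ p := by
    intro i
    rw [Nat.card_eq_fintype_card, Fintype.card_subtype]
    exact IsAddCyclic.card_nsmul_eq_zero_le hp
  let f : (nsmulAddMonoidHom (α := ∀ i : Fin s, ZMod (n i)) p).ker → ∀ i, K i :=
    fun x i => ⟨x.1 i, congrFun x.2 i⟩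
  have hf : Function.Injective f := fun x y h =>
    Subtype.ext (funext fun i => congrArg Subtype.val (congrFun h i))
  calc _ ≤ Nat.card (∀ i, K i) := Nat.card_le_card_of_injective f hf
    _ = ∏ i, Nat.card (K i) := Nat.card_pi
    _ ≤ ∏ _i : Fin s, p := Finset.prod_le_prod' fun i _ => hK i
    _ = p ^ s := by simp

theorem stmt6 (r : ℕ) (hr : 1 ≤ r) :
    ∃ dr : ℝ, 0 < dr ∧
      ∀ s : ℕ, ∀ _hs : 1 ≤ s, s ≤ r →
        ∀ n : Fin s → ℕ, (∀ i, 1 < n i) → (∀ i j : Fin s, i ≤ j → n i ∣ n j) →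
          littleCrossNumber (∀ i : Fin s, ZMod (n i)) ≤
            dr * ((n ⟨s - 1, by omega⟩).primeFactors.card : ℝ) := by
  obtain ⟨C, hC, h⟩ := exists_le_card_eq_nsmul_sum_eq_zero r
  refine ⟨C * 4, by positivity, fun s hs hsr n hn hdvd => ?_⟩
  have hn0 : ∀ i, n i ≠ 0 := fun i => (zero_lt_one.trans (hn i)).ne'
  have : ∀ i, NeZero (n i) := fun i => ⟨hn0 i⟩
  refine Real.sSup_le ?_ (by positivity)
  rintro _ ⟨S, hS, rfl⟩
  rw [mul_assoc]
  refine crossNumber_le_of_isZeroSumFree (hn0 _) (fun g => funext fun i => ?_)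
    (h _ fun p hp => (card_ker_nsmul_pi_zmod_le n hn0 hp.pos).trans
      (Nat.pow_le_pow_right hp.pos hsr)) hS
  have hi : i ≤ ⟨s - 1, by omega⟩ := Fin.mk_le_mk.2 (by omega)
  obtain ⟨c, hc⟩ := hdvd i _ hi
  rw [hc, Pi.smul_apply, nsmul_eq_mul]
  simp
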